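/- Let $f : [a,b] \to \mathbb{R}$ be a smooth function with $f > 0$ and $f' > 0$ on $[a,b]$, such that: (a) $1 - f'(s)^2 - 2 f(s) f''(s) > -3 f(s)^2$ for all $s \in [a,b]$; and (b) $\tfrac{f(b)}{2}(1 - f'(b)^2 + f(b)^2) \geq -f(b)^3$. Then for every real number $m > \tfrac{f(b)}{2}(1 - f'(b)^2 + f(b)^2)$ there exist $c > b$ and a smooth function $\tilde f : [a,\infty) \to \mathbb{R}$ such that: (A) $\tilde f = f$ on $[a,b]$; (B) $\tilde f > 0$ and $\tilde f' > 0$ on $[a,\infty)$; (C) $1 - \tilde f'(s)^2 - 2 \tilde f(s) \tilde f''(s) \geq -3 \tilde f(s)^2$ for all $s \in [a,\infty)$; and (D) for all $s \geq c$ one has $1 + \tilde f(s)^2 - 2m/\tilde f(s) > 0$ and $\tilde f'(s) = \sqrt{1 + \tilde f(s)^2 - 2m/\tilde f(s)}$. -/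

import Mathlib

open Set

open Filter Topology

/-- **Borel's lemma**: every real sequence is the sequence of derivatives at a point of a smooth
function. -/
theorem exists_contDiff_iteratedDeriv_eq (a : ℕ → ℝ) (c : ℝ) :
    ∃ h : ℝ → ℝ, ContDiff ℝ (⊤ : ℕ∞) h ∧ ∀ k, iteratedDeriv k h c = a k := by
  let χ : ContDiffBump (0 : ℝ) := ⟨1, 2, one_pos, one_lt_two⟩
  let ψ : ℕ → ℝ → ℝ := fun n x => x ^ n * χ x
  have hψ (n) : ContDiff ℝ (⊤ : ℕ∞) (ψ n) := (contDiff_id.pow n).mul χ.contDiff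
  have hψc (n) : HasCompactSupport (ψ n) := χ.hasCompactSupport.mul_left
  have hψ0 (n) : ψ n =ᶠ[𝓝 0] fun x => x ^ n := by
    filter_upwards [χ.eventuallyEq_one] with x hx
    simp [ψ, hx]
  have hbd (n k) : ∃ C, ∀ x, ‖iteratedFDeriv ℝ k (ψ n) x‖ ≤ C :=
    ((hψc n).iteratedFDeriv k).exists_bound_of_continuous
      ((hψ n).continuous_iteratedFDeriv (by exact_mod_cast le_top))
  choose C hC using hbd
  have hC0 (n k) : 0 ≤ C n k := (norm_nonneg _).trans (hC n k 0)
  let b : ℕ → ℝ := fun n => a n / n.factorial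
  let S : ℕ → ℝ := fun n => 2 ^ n * |b n| * ∑ k ∈ Finset.range n, C n k
  have hS (n) : 0 ≤ S n := by
    have := Finset.sum_nonneg (s := Finset.range n) fun k _ => hC0 n k
    positivity
  let l : ℕ → ℝ := fun n => 1 + S n
  have hl1 (n) : 1 ≤ l n := by simp [l, hS]
  have hl0 (n) : 0 < l n := one_pos.trans_le (hl1 n)
  let F : ℕ → ℝ → ℝ := fun n x => b n / l n ^ n * ψ n (l n * x)
  have hFs (n) : ContDiff ℝ (⊤ : ℕ∞) (F n) :=
    contDiff_const.mul ((hψ n).comp (contDiff_const.mul contDiff_id))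
  have hF (n k x) : iteratedDeriv k (F n) x =
      b n / l n ^ n * (l n ^ k * iteratedDeriv k (ψ n) (l n * x)) := by
    have h1 : ContDiff ℝ k (ψ n) := (hψ n).of_le (by exact_mod_cast le_top)
    have h2 : ContDiff ℝ k fun x => ψ n (l n * x) :=
      h1.comp (contDiff_const.mul contDiff_id)
    simp only [F]
    rw [iteratedDeriv_const_mul _ h2.contDiffAt, iteratedDeriv_comp_const_mul h1]
  let v : ℕ → ℕ → ℝ := fun k n => |b n| / l n ^ n * (l n ^ k * C n k)
  have hFv (k n x) : ‖iteratedFDeriv ℝ k (F n) x‖ ≤ v k n := by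
    rw [norm_iteratedFDeriv_eq_norm_iteratedDeriv, hF, norm_mul, norm_mul, norm_div, norm_pow,
      norm_pow, ← norm_iteratedFDeriv_eq_norm_iteratedDeriv, Real.norm_eq_abs, Real.norm_eq_abs,
      abs_of_pos (hl0 n)]
    have := hC n k (l n * x)
    have := (hl0 n).le
    simp only [v]
    gcongr
  have hv (k) : Summable (v k) := by
    refine Summable.of_norm_bounded_eventually_nat (g := fun n => (1 / 2 : ℝ) ^ n)
      (summable_geometric_of_lt_one (by norm_num) (by norm_num)) ?_
    filter_upwards [eventually_gt_atTop k] with n hn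
    have hv0 : 0 ≤ v k n := by
      have := hC0 n k
      have := (hl0 n).le
      positivity
    rw [Real.norm_of_nonneg hv0]
    obtain ⟨j, rfl⟩ := Nat.exists_eq_add_of_lt hn
    set n := k + j + 1
    have e : v k n = |b n| * C n k / l n ^ (j + 1) := by
      have := (hl0 n).ne'
      simp only [v]
      rw [show l n ^ n = l n ^ k * l n ^ (j + 1) by rw [← pow_add]; rfl]
      field_simp
    have h1 : l n ≤ l n ^ (j + 1) := le_self_pow₀ (hl1 n) (by simp)
    have h2 : C n k ≤ ∑ i ∈ Finset.range n, C n i :=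
      Finset.single_le_sum (f := C n) (fun i _ => hC0 n i) (Finset.mem_range.2 hn)
    have h3 : 2 ^ n * (|b n| * C n k) ≤ l n := by
      have : 2 ^ n * |b n| * C n k ≤ S n := by simp only [S]; gcongr
      simp only [l]; linarith
    rw [e, div_le_iff₀ (pow_pos (hl0 n) _), one_div, inv_pow]
    rw [inv_mul_eq_div, le_div_iff₀ (by positivity)]
    linarith
  let h : ℝ → ℝ := fun x => ∑' n, F n x
  have hh : ContDiff ℝ (⊤ : ℕ∞) h := contDiff_tsum hFs (fun k _ => hv k) fun k n x _ => hFv k n x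
  have hval (k) : iteratedDeriv k h 0 = a k := by
    have hsum : Summable fun n => iteratedFDeriv ℝ k (F n) 0 :=
      Summable.of_norm_bounded (hv k) fun n => hFv k n 0
    rw [iteratedDeriv_eq_iteratedFDeriv,
      iteratedFDeriv_tsum_apply hFs (fun k _ => hv k) (fun k n x _ => hFv k n x)
        (by exact_mod_cast le_top), ContinuousMultilinearMap.tsum_eval hsum]
    simp only [← iteratedDeriv_eq_iteratedFDeriv, hF, mul_zero]
    rw [tsum_eq_single k]
    · rw [(hψ0 k).iteratedDeriv_eq]
      have := (hl0 k).ne'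
      simp [iteratedDeriv_pow, b, Nat.descFactorial_self]
      field_simp
    · intro n hn
      rw [(hψ0 n).iteratedDeriv_eq]
      rcases lt_or_gt_of_ne hn with h | h
      · simp [iteratedDeriv_pow, Nat.descFactorial_of_lt h]
      · simp [iteratedDeriv_pow, Nat.sub_ne_zero_of_lt h]
  refine ⟨fun x => h (x - c), hh.comp (contDiff_id.sub contDiff_const), fun k => ?_⟩
  rw [iteratedDeriv_comp_sub_const]
  simp [hval]

/-- If each `w k` has derivative `w (k + 1)` everywhere, then `w 0` is smooth. -/
theorem contDiff_of_hasDerivAt_succ {w : ℕ → ℝ → ℝ}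
    (hw : ∀ k x, HasDerivAt (w k) (w (k + 1) x) x) : ContDiff ℝ (⊤ : ℕ∞) (w 0) := by
  rw [contDiff_infty]
  intro n
  suffices h : ∀ k, ContDiff ℝ n (w k) from h 0
  induction n with
  | zero =>
    intro k
    exact contDiff_zero.2 (continuous_iff_continuousAt.2 fun x => (hw k x).continuousAt)
  | succ n ih =>
    intro k
    push_cast
    rw [contDiff_succ_iff_deriv]
    refine ⟨fun x => (hw k x).differentiableAt, by simp, ?_⟩
    rw [show deriv (w k) = w (k + 1) from funext fun x => (hw k x).deriv]
    exact ih _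

theorem hasDerivAt_iteratedDeriv {h : ℝ → ℝ} (hh : ContDiff ℝ (⊤ : ℕ∞) h) (k : ℕ) (x : ℝ) :
    HasDerivAt (iteratedDeriv k h) (iteratedDeriv (k + 1) h x) x := by
  rw [iteratedDeriv_succ]
  exact (hh.differentiable_iteratedDeriv k (by exact_mod_cast WithTop.coe_lt_top k) x).hasDerivAt

/-- A function smooth on a compact interval extends to a smooth function on the line. -/
theorem exists_contDiff_eqOn_Icc {a b : ℝ} (hab : a < b) {f : ℝ → ℝ}
    (hf : ContDiffOn ℝ (⊤ : ℕ∞) f (Icc a b)) :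
    ∃ F : ℝ → ℝ, ContDiff ℝ (⊤ : ℕ∞) F ∧ EqOn F f (Icc a b) := by
  let d : ℕ → ℝ → ℝ := fun k => iteratedDerivWithin k f (Icc a b)
  obtain ⟨p, hp, hpa⟩ := exists_contDiff_iteratedDeriv_eq (fun k => d k a) a
  obtain ⟨q, hq, hqb⟩ := exists_contDiff_iteratedDeriv_eq (fun k => d k b) b
  have hd (k x) (hx : x ∈ Icc a b) : HasDerivWithinAt (d k) (d (k + 1) x) (Icc a b) x := by
    simp only [d, iteratedDerivWithin_succ]
    exact (hf.differentiableOn_iteratedDerivWithin (by exact_mod_cast WithTop.coe_lt_top k)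
      (uniqueDiffOn_Icc hab) x hx).hasDerivWithinAt
  let w : ℕ → ℝ → ℝ := fun k x =>
    if x < a then iteratedDeriv k p x else if x ≤ b then d k x else iteratedDeriv k q x
  have hwp (k) : EqOn (w k) (iteratedDeriv k p) (Iic a) := by
    intro x hx
    rcases (mem_Iic.1 hx).lt_or_eq with h | rfl
    · simp [w, h]
    · simp [w, hab.le, hpa]
  have hwd (k) : EqOn (w k) (d k) (Icc a b) := by
    intro x hx
    simp [w, hx.1, hx.2]
  have hwq (k) : EqOn (w k) (iteratedDeriv k q) (Ici b) := by
    intro x hx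
    have hx' : b ≤ x := hx
    rcases hx'.lt_or_eq with h | rfl
    · simp [w, h.not_ge, (hab.trans h).not_gt]
    · simp [w, hab.le, hqb]
  refine ⟨w 0, contDiff_of_hasDerivAt_succ fun k x => ?_, fun x hx => by simp [hwd 0 hx, d]⟩
  have h1 (hx : x ∈ Iic a) : HasDerivWithinAt (w k) (w (k + 1) x) (Iic a) x := by
    rw [hwp _ hx]
    exact ((hasDerivAt_iteratedDeriv hp k x).hasDerivWithinAt).congr (hwp k) (hwp k hx)
  have h2 (hx : x ∈ Icc a b) : HasDerivWithinAt (w k) (w (k + 1) x) (Icc a b) x := by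
    rw [hwd _ hx]
    exact (hd k x hx).congr (hwd k) (hwd k hx)
  have h3 (hx : x ∈ Ici b) : HasDerivWithinAt (w k) (w (k + 1) x) (Ici b) x := by
    rw [hwq _ hx]
    exact ((hasDerivAt_iteratedDeriv hq k x).hasDerivWithinAt).congr (hwq k) (hwq k hx)
  rcases lt_trichotomy x a with hxa | rfl | hxa
  · exact (h1 hxa.le).hasDerivAt (Iic_mem_nhds hxa)
  · refine ((h1 self_mem_Iic).union (h2 ⟨le_rfl, hab.le⟩)).hasDerivAt ?_
    rw [Iic_union_Icc_eq_Iic hab.le]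
    exact Iic_mem_nhds hab
  rcases lt_trichotomy x b with hxb | rfl | hxb
  · exact (h2 ⟨hxa.le, hxb.le⟩).hasDerivAt (Icc_mem_nhds hxa hxb)
  · refine ((h2 ⟨hab.le, le_rfl⟩).union (h3 self_mem_Ici)).hasDerivAt ?_
    rw [Icc_union_Ici_eq_Ici hab.le]
    exact Ici_mem_nhds hab
  · exact (h3 hxb.le).hasDerivAt (Ici_mem_nhds hxb)

theorem derivWithin_eq_deriv_of_eqOn {f g : ℝ → ℝ} {s : Set ℝ} (hs : UniqueDiffOn ℝ s)
    (hg : Differentiable ℝ g) (h : EqOn f g s) : EqOn (derivWithin f s) (deriv g) s := by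
  intro x hx
  rw [derivWithin_congr h (h hx), (hg x).derivWithin (hs x hx)]

/-- Smooth transition from `u` to a larger function `v` across `[b, c]`, whose derivative there is at
least the minimum of the two derivatives. -/
theorem exists_smooth_blend {u v : ℝ → ℝ} {b c : ℝ} (hbc : b < c)
    (hu : ContDiff ℝ (⊤ : ℕ∞) u) (hv : ContDiff ℝ (⊤ : ℕ∞) v) (huv : ∀ t ∈ Icc b c, u t ≤ v t) :
    ∃ w : ℝ → ℝ, ContDiff ℝ (⊤ : ℕ∞) w ∧ (∀ t ≤ b, w t = u t) ∧ (∀ t, c ≤ t → w t = v t) ∧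
      (∀ t ∈ Icc b c, w t ≤ v t) ∧ ∀ t ∈ Icc b c, min (deriv u t) (deriv v t) ≤ deriv w t := by
  let η : ℝ → ℝ := fun t => Real.smoothTransition ((t - b) / (c - b))
  have hcb : 0 < c - b := sub_pos.2 hbc
  have hη : ContDiff ℝ (⊤ : ℕ∞) η :=
    Real.smoothTransition.contDiff.comp ((contDiff_id.sub contDiff_const).div_const _)
  have hmono : Monotone η := Real.smoothTransition.monotone.comp fun x y h => by
    change (x - b) / (c - b) ≤ (y - b) / (c - b)
    gcongr
  have h0 (t) : 0 ≤ η t := Real.smoothTransition.nonneg _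
  have h1 (t) : η t ≤ 1 := Real.smoothTransition.le_one _
  refine ⟨fun t => (1 - η t) * u t + η t * v t,
    ((contDiff_const.sub hη).mul hu).add (hη.mul hv), fun t ht => ?_, fun t ht => ?_,
    fun t ht => ?_, fun t ht => ?_⟩
  · have : η t = 0 := Real.smoothTransition.zero_of_nonpos
      (div_nonpos_of_nonpos_of_nonneg (by linarith) hcb.le)
    simp [this]
  · have : η t = 1 := Real.smoothTransition.one_of_one_le
      ((one_le_div hcb).2 (by linarith))
    simp [this]
  · nlinarith [mul_nonneg (sub_nonneg.2 (h1 t)) (sub_nonneg.2 (huv t ht))]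
  · have dη := (hη.differentiable (by simp) t).hasDerivAt
    have du := (hu.differentiable (by simp) t).hasDerivAt
    have dv := (hv.differentiable (by simp) t).hasDerivAt
    have hd := (((dη.const_sub 1).mul du).add (dη.mul dv)).deriv
    have key := hmono.deriv_nonneg (x := t)
    change _ ≤ deriv ((fun t => 1 - η t) * u + η * v) t
    rw [hd]
    nlinarith [mul_nonneg key (sub_nonneg.2 (huv t ht)),
      mul_le_mul_of_nonneg_left (min_le_left (deriv u t) (deriv v t)) (sub_nonneg.2 (h1 t)),
      mul_le_mul_of_nonneg_left (min_le_right (deriv u t) (deriv v t)) (h0 t)]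

/-- If `k` is smooth and bounded below by a positive constant, the autonomous equation `θ' = 1 / k(θ)`
has a global smooth solution, increasing and onto; it is the identity on `(-∞, b]` if `k = 1` there. -/
theorem exists_smooth_inverse_primitive {k : ℝ → ℝ} {b κ : ℝ} (hk : ContDiff ℝ (⊤ : ℕ∞) k)
    (hκ : 0 < κ) (hkκ : ∀ t, κ ≤ k t) (hkb : ∀ t ≤ b, k t = 1) :
    ∃ θ : ℝ → ℝ, ContDiff ℝ (⊤ : ℕ∞) θ ∧ (∀ s, HasDerivAt θ (k (θ s))⁻¹ s) ∧ StrictMono θ ∧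
      Function.Surjective θ ∧ ∀ s ≤ b, θ s = s := by
  let T : ℝ → ℝ := fun t => b + ∫ x in b..t, k x
  have hT (t) : HasDerivAt T (k t) t :=
    (intervalIntegral.integral_hasDerivAt_right (hk.continuous.intervalIntegrable _ _)
      (hk.continuous.stronglyMeasurableAtFilter _ _) hk.continuous.continuousAt).const_add b
  have hk0 (t) : 0 < k t := hκ.trans_le (hkκ t)
  have hTc : ContDiff ℝ (⊤ : ℕ∞) T := by
    rw [contDiff_infty_iff_deriv, show deriv T = k from funext fun x => (hT x).deriv]
    exact ⟨fun x => (hT x).differentiableAt, hk⟩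
  have hTm : StrictMono T := strictMono_of_deriv_pos fun t => by rw [(hT t).deriv]; exact hk0 t
  have hTb : T b = b := by simp [T]
  have hlin : Monotone fun t => T t - κ * t := by
    have hd (t) : HasDerivAt (fun t => T t - κ * t) (k t - κ * 1) t :=
      (hT t).sub ((hasDerivAt_id t).const_mul κ)
    refine monotone_of_deriv_nonneg (fun t => (hd t).differentiableAt) fun t => ?_
    rw [(hd t).deriv]
    linarith [hkκ t]
  have htop : Tendsto T atTop atTop := by
    refine tendsto_atTop_mono' _ ?_
      (tendsto_atTop_add_const_left atTop (b - κ * b) (tendsto_id.const_mul_atTop hκ))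
    filter_upwards [eventually_ge_atTop b] with t ht
    have := hlin ht
    simp only [hTb, id] at this ⊢
    linarith
  have hbot : Tendsto T atBot atBot := by
    refine tendsto_atBot_mono' _ ?_
      (tendsto_atBot_add_const_left atBot (b - κ * b) (tendsto_id.const_mul_atBot hκ))
    filter_upwards [eventually_le_atBot b] with t ht
    have := hlin ht
    simp only [hTb, id] at this ⊢
    linarith
  let e : ℝ ≃o ℝ := hTm.orderIsoOfSurjective T (hTc.continuous.surjective htop hbot)
  have hθ : ContDiff ℝ (⊤ : ℕ∞) e.symm :=
    e.toHomeomorph.contDiff_symm_deriv (fun t => (hk0 t).ne') hT hTc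
  refine ⟨e.symm, hθ, fun s => ?_, e.symm.strictMono, e.symm.surjective, fun s hs => ?_⟩
  · exact (hT (e.symm s)).of_local_left_inverse hθ.continuous.continuousAt (hk0 _).ne'
      (Eventually.of_forall fun y => e.apply_symm_apply y)
  · rw [OrderIso.symm_apply_eq]
    change s = b + ∫ x in b..s, k x
    rw [intervalIntegral.integral_congr (g := fun _ => 1) fun x hx => hkb x ?_]
    · simp
    · rw [uIcc_of_ge hs] at hx
      exact hx.2

theorem deriv_eqOn_of_eqOn {f g : ℝ → ℝ} {s : Set ℝ} (hs : UniqueDiffOn ℝ s)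
    (hf : Differentiable ℝ f) (hg : Differentiable ℝ g) (h : EqOn f g s) :
    EqOn (deriv f) (deriv g) s := fun x hx => by
  rw [← derivWithin_eq_deriv_of_eqOn hs hg h hx, (hf x).derivWithin (hs x hx)]

/-- The derivative of the hyperbolic Hawking mass of the coordinate spheres. -/
theorem hasDerivAt_hawkingMass {F : ℝ → ℝ} (hF : ContDiff ℝ (⊤ : ℕ∞) F) (t : ℝ) :
    HasDerivAt (fun t => F t / 2 * (1 - deriv F t ^ 2 + F t ^ 2))
      (deriv F t / 2 * (1 - deriv F t ^ 2 - 2 * F t * deriv (deriv F) t + 3 * F t ^ 2)) t := by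
  have h1 := (hF.differentiable (by simp) t).hasDerivAt
  have h2 := (((contDiff_infty_iff_deriv.1 hF).2).differentiable (by simp) t).hasDerivAt
  refine ((h1.div_const 2).mul (((h2.pow 2).const_sub 1).add (h1.pow 2))).congr_deriv ?_
  simp only [Pi.add_apply, Pi.pow_apply]
  push_cast
  ring

/-- An increasing profile `F` continuing `F₀`, and a nondecreasing mass function `μ` continuing `M₀`
which eventually equals `m`, such that `1 + F ^ 2 - 2 * μ / F` stays positive. -/
theorem exists_profile_and_mass {F₀ M₀ : ℝ → ℝ} {b m : ℝ} (hF₀ : ContDiff ℝ (⊤ : ℕ∞) F₀)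
    (hM₀ : ContDiff ℝ (⊤ : ℕ∞) M₀) (hFb : 0 < F₀ b) (hFb' : 0 < deriv F₀ b)
    (hMb' : 0 < deriv M₀ b) (hm : M₀ b < m) (hR : M₀ b < (F₀ b + F₀ b ^ 3) / 2) :
    ∃ L F μ, b < L ∧ ContDiff ℝ (⊤ : ℕ∞) F ∧ ContDiff ℝ (⊤ : ℕ∞) μ ∧ EqOn F F₀ (Iic b) ∧
      EqOn μ M₀ (Iic b) ∧
      (∀ t, b ≤ t → 0 < F t ∧ 0 < deriv F t ∧ 0 ≤ deriv μ t ∧ 2 * μ t < F t + F t ^ 3) ∧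
      ∀ t, L ≤ t → μ t = m ∧ 1 ≤ F t ∧ deriv F t = F t := by
  obtain ⟨m₁, hm₁, hm₁'⟩ := exists_between (lt_min hm hR)
  obtain ⟨hm₁m, hm₁R⟩ := lt_min_iff.1 hm₁'
  have hdF : ContDiff ℝ (⊤ : ℕ∞) (deriv F₀) := (contDiff_infty_iff_deriv.1 hF₀).2
  have hdM : ContDiff ℝ (⊤ : ℕ∞) (deriv M₀) := (contDiff_infty_iff_deriv.1 hM₀).2
  have hev : ∀ᶠ t in 𝓝 b, 0 < deriv F₀ t ∧ 0 < deriv M₀ t ∧ M₀ t < m₁ :=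
    (hdF.continuous.continuousAt.eventually (lt_mem_nhds hFb')).and
      ((hdM.continuous.continuousAt.eventually (lt_mem_nhds hMb')).and
        (hM₀.continuous.continuousAt.eventually (gt_mem_nhds hm₁)))
  obtain ⟨ε, hε, hball⟩ := Metric.eventually_nhds_iff.1 hev
  obtain ⟨c, hbc, hcε⟩ : ∃ c, b < c ∧ c < b + ε := exists_between (by linarith)
  have hnear (t) (ht : t ∈ Icc b c) : 0 < deriv F₀ t ∧ 0 < deriv M₀ t ∧ M₀ t < m₁ :=
    hball (by rw [Real.dist_eq, abs_lt]; constructor <;> linarith [ht.1, ht.2])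
  obtain ⟨C, hC⟩ := (isCompact_Icc (a := b) (b := c)).exists_bound_of_continuousOn
    hF₀.continuous.continuousOn
  let A : ℝ := 1 + |C|
  have hA1 : 1 ≤ A := by simp [A]
  let E : ℝ → ℝ := fun t => A * Real.exp (t - b)
  have hE : ContDiff ℝ (⊤ : ℕ∞) E :=
    contDiff_const.mul (Real.contDiff_exp.comp (contDiff_id.sub contDiff_const))
  have hE' (t) : deriv E t = E t := by
    have : HasDerivAt E (A * (Real.exp (t - b) * 1)) t :=
      (((hasDerivAt_id t).sub_const b).exp).const_mul A
    simpa using this.deriv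
  have hElin (t) (ht : b ≤ t) : t - b + 1 ≤ E t := by
    have := Real.add_one_le_exp (t - b)
    simp only [E]
    nlinarith
  have hEA (t) (ht : b ≤ t) : A ≤ E t :=
    le_mul_of_one_le_right (by linarith) (Real.one_le_exp (by linarith))
  have hE0 (t) : 0 < E t := mul_pos (by linarith) (Real.exp_pos _)
  obtain ⟨F, hF, hFl, hFr, -, hFd⟩ := exists_smooth_blend hbc hF₀ hE fun t ht => by
    have h1 := (le_abs_self _).trans (hC t ht)
    have h2 := hEA t ht.1
    have h3 := le_abs_self C
    simp only [A] at h2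
    linarith
  have hFdiff : Differentiable ℝ F := hF.differentiable (by simp)
  have hFr' (t) (ht : c ≤ t) : deriv F t = F t := by
    rw [deriv_eqOn_of_eqOn (uniqueDiffOn_Ici c) hFdiff (hE.differentiable (by simp)) hFr ht,
      hE', hFr t ht]
  have hFpos' (t) (ht : b ≤ t) : 0 < deriv F t := by
    rcases le_total t c with h | h
    · refine lt_of_lt_of_le (lt_min (hnear t ⟨ht, h⟩).1 ?_) (hFd t ⟨ht, h⟩)
      rw [hE']
      exact hE0 t
    · rw [hFr' t h, hFr t h]
      exact hE0 t
  have hFmono : MonotoneOn F (Ici b) :=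
    monotoneOn_of_deriv_nonneg (convex_Ici b) hFdiff.continuous.continuousOn
      hFdiff.differentiableOn fun t ht => (hFpos' t (interior_subset ht)).le
  have hFge (t) (ht : b ≤ t) : F₀ b ≤ F t := by
    rw [← hFl b le_rfl]
    exact hFmono self_mem_Ici ht ht
  obtain ⟨μ₁, hμ₁, hμ₁l, hμ₁r, hμ₁le, hμ₁d⟩ := exists_smooth_blend (v := fun _ => m₁) hbc hM₀
    contDiff_const fun t ht => (hnear t ht).2.2.le
  have hμ₁pos' (t) (ht : b ≤ t) : 0 ≤ deriv μ₁ t := by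
    rcases le_total t c with h | h
    · exact (le_min (hnear t ⟨ht, h⟩).2.1.le (by simp)).trans (hμ₁d t ⟨ht, h⟩)
    · rw [deriv_eqOn_of_eqOn (uniqueDiffOn_Ici c) (hμ₁.differentiable (by simp))
        (differentiable_const m₁) hμ₁r h]
      simp
  have hμ₁m (t) (ht : b ≤ t) : μ₁ t ≤ m₁ := by
    rcases le_total t c with h | h
    · exact hμ₁le t ⟨ht, h⟩
    · exact (hμ₁r t h).le
  let L : ℝ := max c (b + 2 * |m|)
  have hcL : c ≤ L := le_max_left _ _
  have hbL : b < L := hbc.trans_le hcL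
  have hFL (t) (ht : L ≤ t) : 2 * |m| + 1 ≤ F t := by
    rw [hFr t (hcL.trans ht)]
    have h1 := hElin t (hbL.le.trans ht)
    have h2 : b + 2 * |m| ≤ L := le_max_right _ _
    linarith
  have hFm (t) (ht : L ≤ t) : 2 * m < F t + F t ^ 3 := by
    have h1 := hFL t ht
    have h2 := le_abs_self m
    have h3 : 0 < F t := by linarith [abs_nonneg m]
    have := pow_pos h3 3
    linarith
  obtain ⟨μ, hμ, hμl, hμr, hμle, hμd⟩ := exists_smooth_blend (u := μ₁) (v := fun _ => m)
    (lt_add_one L) hμ₁ contDiff_const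
    fun t ht => (hμ₁m t (hbL.le.trans ht.1)).trans hm₁m.le
  have hμdiff : Differentiable ℝ μ := hμ.differentiable (by simp)
  refine ⟨L + 1, F, μ, by linarith, hF, hμ, hFl, fun t ht => ?_, fun t ht => ?_, fun t ht => ?_⟩
  · rw [hμl t (ht.trans hbL.le), hμ₁l t ht]
  · have hFt := hFge t ht
    refine ⟨hFb.trans_le hFt, hFpos' t ht, ?_, ?_⟩
    · rcases le_total t L with h | h
      · rw [deriv_eqOn_of_eqOn (uniqueDiffOn_Iic L) hμdiff (hμ₁.differentiable (by simp)) hμl h]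
        exact hμ₁pos' t ht
      rcases le_total t (L + 1) with h' | h'
      · exact (le_min (hμ₁pos' t ht) (by simp)).trans (hμd t ⟨h, h'⟩)
      · rw [deriv_eqOn_of_eqOn (uniqueDiffOn_Ici (L + 1)) hμdiff (differentiable_const m) hμr h']
        simp
    · rcases le_total t L with h | h
      · rw [hμl t h]
        have h1 := hμ₁m t ht
        have h2 : F₀ b ^ 3 ≤ F t ^ 3 := by gcongr
        linarith
      · have h1 : μ t ≤ m := by
          rcases le_total t (L + 1) with h' | h'
          · exact hμle t ⟨h, h'⟩
          · exact (hμr t h').le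
        linarith [hFm t h]
  · have h1 : L ≤ t := by linarith
    exact ⟨hμr t ht, by linarith [hFL t h1, abs_nonneg m], hFr' t (hcL.trans h1)⟩

theorem sqrt_adsRadicand_le {x m : ℝ} (hx : 1 ≤ x) :
    √(1 + x ^ 2 - 2 * m / x) ≤ (2 + 2 * |m|) * x := by
  have h0 : 0 < x := by linarith
  have hm := abs_nonneg m
  refine Real.sqrt_le_iff.2 ⟨by positivity, ?_⟩
  have h1 : -(2 * m / x) ≤ 2 * |m| := by
    rw [← neg_div, div_le_iff₀ h0]
    nlinarith [neg_abs_le m]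
  nlinarith [mul_nonneg hm (sub_nonneg.2 hx), mul_nonneg hm hm, sq_nonneg x,
    mul_nonneg (mul_nonneg hm hm) (sq_nonneg x),
    mul_nonneg hm (sub_nonneg.2 (one_le_pow₀ hx (n := 2)))]

/-- A positive continuous function bounded below near both ends of the line is bounded below. -/
theorem exists_lower_bound_of_pos {k : ℝ → ℝ} {b L κ : ℝ} (hk : Continuous k) (hpos : ∀ t, 0 < k t)
    (hκ : 0 < κ) (hl : ∀ t ≤ b, κ ≤ k t) (hr : ∀ t, L ≤ t → κ ≤ k t) :
    ∃ κ' > 0, ∀ t, κ' ≤ k t := by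
  obtain h | h := lt_or_ge L b
  · exact ⟨κ, hκ, fun t => (le_total t b).elim (hl t) fun ht => hr t (h.le.trans ht)⟩
  obtain ⟨x, -, hx⟩ := (isCompact_Icc (a := b) (b := L)).exists_isMinOn ⟨b, le_rfl, h⟩
    hk.continuousOn
  refine ⟨min κ (k x), lt_min hκ (hpos x), fun t => ?_⟩
  rcases le_total t b with h1 | h1
  · exact (min_le_left _ _).trans (hl t h1)
  rcases le_total t L with h2 | h2
  · exact (min_le_right _ _).trans (hx ⟨h1, h2⟩)
  · exact (min_le_left _ _).trans (hr t h2)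

/-- Gluing to an AdS-Schwarzschild manifold (radial profile form): a smooth increasing
positive profile with scalar curvature `> -6` (i.e. `1 - f'^2 - 2 f f'' > -3 f^2`) and
hyperbolic Hawking mass at the outer boundary at least `-f(b)^3` can be smoothly
extended to `[a,∞)` with scalar curvature `≥ -6`, eventually coinciding with the
exterior AdS-Schwarzschild profile of any mass `m` exceeding the boundary hyperbolic
Hawking mass. -/
theorem gluing_to_AdS_Schwarzschild
    (a b : ℝ) (hab : a < b) (f : ℝ → ℝ)
    (hf : ContDiffOn ℝ (⊤ : ℕ∞) f (Icc a b))
    (hpos : ∀ s ∈ Icc a b, 0 < f s ∧ 0 < derivWithin f (Icc a b) s)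
    (hscal : ∀ s ∈ Icc a b,
      -3 * (f s) ^ 2 < 1 - (derivWithin f (Icc a b) s) ^ 2
        - 2 * f s * derivWithin (derivWithin f (Icc a b)) (Icc a b) s)
    (hHawking : -(f b) ^ 3 ≤ f b / 2 * (1 - (derivWithin f (Icc a b) b) ^ 2 + (f b) ^ 2)) :
    ∀ m : ℝ, f b / 2 * (1 - (derivWithin f (Icc a b) b) ^ 2 + (f b) ^ 2) < m →
    ∃ c : ℝ, b < c ∧ ∃ g : ℝ → ℝ, ContDiffOn ℝ (⊤ : ℕ∞) g (Ici a) ∧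
      (∀ s ∈ Icc a b, g s = f s) ∧
      (∀ s ∈ Ici a, 0 < g s ∧ 0 < derivWithin g (Ici a) s) ∧
      (∀ s ∈ Ici a,
        -3 * (g s) ^ 2 ≤ 1 - (derivWithin g (Ici a) s) ^ 2
          - 2 * g s * derivWithin (derivWithin g (Ici a)) (Ici a) s) ∧
      (∀ s : ℝ, c ≤ s → 0 < 1 + (g s) ^ 2 - 2 * m / g s ∧
        derivWithin g (Ici a) s = Real.sqrt (1 + (g s) ^ 2 - 2 * m / g s)) := by
  intro m hm
  obtain ⟨F₀, hF₀, hF₀f⟩ := exists_contDiff_eqOn_Icc hab hf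
  have hI := uniqueDiffOn_Icc hab
  have hF₀' : ContDiff ℝ (⊤ : ℕ∞) (deriv F₀) := (contDiff_infty_iff_deriv.1 hF₀).2
  have hF₀d : Differentiable ℝ F₀ := hF₀.differentiable (by simp)
  have hd1 := derivWithin_eq_deriv_of_eqOn hI hF₀d hF₀f.symm
  have hd2 := derivWithin_eq_deriv_of_eqOn hI (hF₀'.differentiable (by simp)) hd1
  have hbI : b ∈ Icc a b := ⟨hab.le, le_rfl⟩
  have hpos₀ (s) (hs : s ∈ Icc a b) : 0 < F₀ s ∧ 0 < deriv F₀ s := by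
    rw [hF₀f hs, ← hd1 hs]
    exact hpos s hs
  let M₀ : ℝ → ℝ := fun t => F₀ t / 2 * (1 - deriv F₀ t ^ 2 + F₀ t ^ 2)
  have hM₀ : ContDiff ℝ (⊤ : ℕ∞) M₀ :=
    (hF₀.div_const 2).mul ((contDiff_const.sub (hF₀'.pow 2)).add (hF₀.pow 2))
  have hMb' : 0 < deriv M₀ b := by
    rw [(hasDerivAt_hawkingMass hF₀ b).deriv]
    have := hscal b hbI
    rw [hd1 hbI, hd2 hbI, ← hF₀f hbI] at this
    exact mul_pos (half_pos (hpos₀ b hbI).2) (by linarith)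
  have hMb : M₀ b < m := by
    rw [hd1 hbI, ← hF₀f hbI] at hm
    exact hm
  obtain ⟨L, F, μ, hbL, hF, hμ, hFl, hμl, hr, hL⟩ := exists_profile_and_mass hF₀ hM₀
    (hpos₀ b hbI).1 (hpos₀ b hbI).2 hMb' hMb (by
      have := mul_pos (hpos₀ b hbI).1 (pow_pos (hpos₀ b hbI).2 2)
      simp only [M₀]
      nlinarith)
  have hFd : Differentiable ℝ F := hF.differentiable (by simp)
  have hF' : ContDiff ℝ (⊤ : ℕ∞) (deriv F) := (contDiff_infty_iff_deriv.1 hF).2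
  have hFl' := deriv_eqOn_of_eqOn (uniqueDiffOn_Iic b) hFd hF₀d hFl
  have hFpos (t) (ht : a ≤ t) : 0 < F t ∧ 0 < deriv F t := by
    rcases le_total t b with h | h
    · rw [hFl h, hFl' h]
      exact hpos₀ t ⟨ht, h⟩
    · exact ⟨(hr t h).1, (hr t h).2.1⟩
  let R : ℝ → ℝ := fun t => 1 + F t ^ 2 - 2 * μ t / F t
  have hRl (t) (ht : t ∈ Icc a b) : R t = deriv F t ^ 2 := by
    have h0 := (hpos₀ t ht).1.ne'
    simp only [R]
    rw [hFl ht.2, hFl' ht.2, hμl ht.2]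
    simp only [M₀]
    field_simp
    ring
  have hRpos (t) (ht : a ≤ t) : 0 < R t := by
    rcases le_total t b with h | h
    · rw [hRl t ⟨ht, h⟩]
      exact pow_pos (hFpos t ht).2 2
    · obtain ⟨h0, -, -, h3⟩ := hr t h
      have : 2 * μ t / F t < 1 + F t ^ 2 := by
        rw [div_lt_iff₀ h0]
        linarith
      exact sub_pos.2 this
  let k : ℝ → ℝ := fun t => if t ≤ b then 1 else deriv F t / √(R t)
  have hkl (t) (ht : t ≤ b) : k t = 1 := if_pos ht
  have hkr (t) (ht : a ≤ t) : k t = deriv F t / √(R t) := by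
    rcases le_or_gt t b with h | h
    · have h0 := (hFpos t ht).2
      rw [hkl t h, hRl t ⟨ht, h⟩, Real.sqrt_sq h0.le, div_self h0.ne']
    · exact if_neg h.not_ge
  have hk0 (t) : 0 < k t := by
    rcases le_total t a with h | h
    · rw [hkl t (h.trans hab.le)]
      exact one_pos
    · rw [hkr t h]
      exact div_pos (hFpos t h).2 (Real.sqrt_pos.2 (hRpos t h))
  have hk : ContDiff ℝ (⊤ : ℕ∞) k := by
    rw [contDiff_iff_contDiffAt]
    intro t
    rcases lt_or_ge t b with h | h
    · exact contDiffAt_const.congr_of_eventuallyEq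
        (eventually_of_mem (Iio_mem_nhds h) fun x hx => hkl x (le_of_lt hx))
    · have hat : a < t := hab.trans_le h
      have hRt : ContDiffAt ℝ (⊤ : ℕ∞) R t :=
        (contDiffAt_const.add (hF.contDiffAt.pow 2)).sub
          ((contDiffAt_const.mul hμ.contDiffAt).div hF.contDiffAt (hFpos t hat.le).1.ne')
      exact (hF'.contDiffAt.div (hRt.sqrt (hRpos t hat.le).ne')
        (Real.sqrt_pos.2 (hRpos t hat.le)).ne').congr_of_eventuallyEq
        (eventually_of_mem (Ioi_mem_nhds hat) fun x hx => hkr x (le_of_lt hx))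
  have hm2 : 1 ≤ 2 + 2 * |m| := by linarith [abs_nonneg m]
  obtain ⟨κ, hκ, hkκ⟩ : ∃ κ > 0, ∀ t, κ ≤ k t := by
    refine exists_lower_bound_of_pos (b := b) (L := L) (κ := (2 + 2 * |m|)⁻¹) hk.continuous hk0
      (by positivity) (fun t ht => ?_) fun t ht => ?_
    · rw [hkl t ht]
      exact inv_le_one_of_one_le₀ hm2
    · obtain ⟨h1, h2, h3⟩ := hL t ht
      have hat : a ≤ t := (hab.trans hbL).le.trans ht
      rw [hkr t hat, le_div_iff₀ (Real.sqrt_pos.2 (hRpos t hat)), inv_mul_le_iff₀ (by linarith), h3]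
      simp only [R, h1]
      exact sqrt_adsRadicand_le h2
  obtain ⟨θ, hθ, hθ', hθm, hθs, hθl⟩ := exists_smooth_inverse_primitive hk hκ hkκ hkl
  have hθb (s) (hs : b ≤ s) : b ≤ θ s := by
    rw [← hθl b le_rfl]
    exact hθm.monotone hs
  have hθa (s) (hs : a ≤ s) : a ≤ θ s := by
    rw [← hθl a hab.le]
    exact hθm.monotone hs
  let g : ℝ → ℝ := F ∘ θ
  have hg : ContDiff ℝ (⊤ : ℕ∞) g := hF.comp hθ
  have hg' (s) (hs : a ≤ s) : deriv g s = √(R (θ s)) := by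
    have h1 : HasDerivAt g (deriv F (θ s) * (k (θ s))⁻¹) s := (hFd (θ s)).hasDerivAt.comp s (hθ' s)
    have h2 := (hFpos _ (hθa s hs)).2.ne'
    rw [h1.deriv, hkr _ (hθa s hs)]
    field_simp
  have hgf : EqOn g f (Icc a b) := fun s hs => by
    simp only [g, Function.comp, hθl s hs.2, hFl hs.2, hF₀f hs]
  have hgd : Differentiable ℝ g := hg.differentiable (by simp)
  have hgd' : Differentiable ℝ (deriv g) :=
    ((contDiff_infty_iff_deriv.1 hg).2).differentiable (by simp)
  have hJ := uniqueDiffOn_Ici a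
  have e1 := derivWithin_eq_deriv_of_eqOn hJ hgd (eqOn_refl g _)
  have e2 := derivWithin_eq_deriv_of_eqOn hJ hgd' e1
  have i1 := derivWithin_eq_deriv_of_eqOn hI hgd hgf.symm
  have i2 := derivWithin_eq_deriv_of_eqOn hI hgd' i1
  obtain ⟨c, hc⟩ := hθs L
  have hbc : b < c := by
    rw [← hθm.lt_iff_lt, hc, hθl b le_rfl]
    exact hbL
  refine ⟨c, hbc, g, hg.contDiffOn, hgf, fun s hs => ?_, fun s hs => ?_, fun s hs => ?_⟩
  · rw [e1 hs, hg' s hs]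
    exact ⟨(hFpos _ (hθa s hs)).1, Real.sqrt_pos.2 (hRpos _ (hθa s hs))⟩
  · rw [e1 hs, e2 hs]
    rcases le_or_gt s b with h | h
    · have hsI : s ∈ Icc a b := ⟨hs, h⟩
      rw [← i1 hsI, ← i2 hsI, hgf hsI]
      exact (hscal s hsI).le
    · have hg0 : 0 < g s := (hFpos _ (hθa s hs)).1
      have hR0 := hRpos _ (hθa s hs)
      have hv0 : 0 < deriv g s := by
        rw [hg' s hs]
        exact Real.sqrt_pos.2 hR0
      have hsq : deriv g s ^ 2 = 1 + g s ^ 2 - 2 * μ (θ s) / g s := by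
        rw [hg' s hs, Real.sq_sqrt hR0.le]
        rfl
      have hdμ : HasDerivAt (fun x => μ (θ x)) (deriv μ (θ s) * (k (θ s))⁻¹) s :=
        ((hμ.differentiable (by simp) _).hasDerivAt).comp s (hθ' s)
      have hμ0 : 0 ≤ deriv μ (θ s) * (k (θ s))⁻¹ :=
        mul_nonneg (hr _ (hθb s h.le)).2.2.1 (inv_nonneg.2 (hk0 _).le)
      have hM : (fun x => g x / 2 * (1 - deriv g x ^ 2 + g x ^ 2)) =ᶠ[𝓝 s] fun x => μ (θ x) := by
        filter_upwards [Ioi_mem_nhds h] with x hx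
        have hx' : a ≤ x := hab.le.trans (le_of_lt hx)
        have hgx : F (θ x) ≠ 0 := (hFpos _ (hθa x hx')).1.ne'
        rw [hg' x hx', Real.sq_sqrt (hRpos _ (hθa x hx')).le]
        simp only [R, g, Function.comp]
        field_simp
        ring
      have hkey := (hasDerivAt_hawkingMass hg s).unique (hdμ.congr_of_eventuallyEq hM)
      rw [← hkey] at hμ0
      have := nonneg_of_mul_nonneg_right hμ0 (half_pos hv0)
      linarith
  · have hLs : L ≤ θ s := by
      rw [← hc]
      exact hθm.monotone hs
    have hsa : a ≤ s := (hab.trans hbc).le.trans hs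
    have h1 := hRpos _ (hθa s hsa)
    rw [e1 hsa, hg' s hsa]
    simp only [R, (hL _ hLs).1] at h1 ⊢
    exact ⟨h1, rfl⟩
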